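/- The class FAS has a 0–1 law: for every first-order sentence σ in the signature with one unary function symbol f, one unary relation symbol I, and one ternary relation symbol T, the limit as n → ∞ of the fraction of FAS structures with universe {1,…,n} that satisfy σ exists and is equal to 0 or 1. -/

import Mathlib

open Filter Topology FirstOrder

/-- Function symbols of the signature `{f, I, T}`: one unary function `f`. -/
inductive FASFunc : ℕ → Type
  | f : FASFunc 1

/-- Relation symbols of the signature `{f, I, T}`: a unary relation `I` and a
ternary relation `T`. -/
inductive FASRel : ℕ → Type
  | i : FASRel 1
  | t : FASRel 3

/-- The first-order signature with one unary function symbol `f`, one unary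
relation symbol `I`, and one ternary relation symbol `T`. -/
def fasLang : Language := ⟨FASFunc, FASRel⟩

/-- Labelled FAS-type data on the universe `Fin n`. -/
abbrev FASData (n : ℕ) :=
  (Fin n → Fin n) × Finset (Fin n) × Finset (Fin n × Fin n × Fin n)

/-- The conditions (P) and (I) defining FAS structures. -/
def IsFAS {n : ℕ} (M : FASData n) : Prop :=
  (∀ a b c : Fin n, (a, b, c) ∈ M.2.2 → (M.1 a, c, b) ∈ M.2.2 ∧ (c, M.1 b, a) ∈ M.2.2) ∧
  (∀ a b : Fin n, a = b ↔ ∃ i ∈ M.2.1, (a, i, b) ∈ M.2.2)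

/-- A structure is symmetric iff `f` is the identity. -/
def FASSymmetric {n : ℕ} (M : FASData n) : Prop := ∀ x, M.1 x = x

/-- A structure is integral iff `|I| = 1`. -/
def FASIntegral {n : ℕ} (M : FASData n) : Prop := M.2.1.card = 1

/-- The `fasLang`-structure on `Fin n` determined by `M`. -/
def toStructure {n : ℕ} (M : FASData n) : fasLang.Structure (Fin n) where
  funMap {l} F v :=
    match F with
    | .f => M.1 (v 0)
  RelMap {l} r v :=
    match r with
    | .i => v 0 ∈ M.2.1
    | .t => (v 0, v 1, v 2) ∈ M.2.2

/-- `M` satisfies the first-order sentence `σ`. -/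
def SatSentence {n : ℕ} (M : FASData n) (σ : fasLang.Sentence) : Prop :=
  @FirstOrder.Language.Sentence.Realize fasLang (Fin n) (toStructure M) σ

/-- Multisets of three elements, as elements of `Sym α 3`. -/
def symTriple {α : Type*} (a b c : α) : Sym α 3 := a ::ₛ b ::ₛ c ::ₛ Sym.nil

/-- `M` is a symmetric integral FAS structure with identity element `e`. -/
def IsSymmIntegral {n : ℕ} (M : FASData n) (e : Fin n) : Prop :=
  IsFAS M ∧ M.1 = id ∧ M.2.1 = {e}

/-- The extension property for `k`-tuples: every pattern over every `k`-tuple that is invariant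
under the symmetries of `T` is realized by a new element. -/
def HasExtension (k : ℕ) {n : ℕ} (M : FASData n) (e : Fin n) : Prop :=
  ∀ (w : Fin k → Fin n) (Q : Finset (Fin (k + 1) × Fin (k + 1))),
    ∃ b, b ≠ e ∧ (∀ i, w i ≠ b) ∧
      ∀ i j, (Fin.snoc w b : Fin (k + 1) → Fin n) i ≠ e →
        (Fin.snoc w b : Fin (k + 1) → Fin n) j ≠ e →
        (((Fin.snoc w b : Fin (k + 1) → Fin n) i, (Fin.snoc w b : Fin (k + 1) → Fin n) j, b) ∈
          M.2.2 ↔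
          ∃ p ∈ Q, s((Fin.snoc w b : Fin (k + 1) → Fin n) p.1,
            (Fin.snoc w b : Fin (k + 1) → Fin n) p.2) =
            s((Fin.snoc w b : Fin (k + 1) → Fin n) i, (Fin.snoc w b : Fin (k + 1) → Fin n) j))

/-- The tuples `v` and `w` have the same quantifier-free type. -/
def PartialIso {n m k : ℕ} (M : FASData n) (e : Fin n) (M' : FASData m) (e' : Fin m)
    (v : Fin k → Fin n) (w : Fin k → Fin m) : Prop :=
  (∀ i, v i = e ↔ w i = e') ∧ (∀ i j, v i = v j ↔ w i = w j) ∧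
    ∀ i j l, (v i, v j, v l) ∈ M.2.2 ↔ (w i, w j, w l) ∈ M'.2.2

namespace IsSymmIntegral

variable {n : ℕ} {M : FASData n} {e : Fin n}

theorem swap_right (h : IsSymmIntegral M e) (a b c : Fin n) :
    (a, b, c) ∈ M.2.2 ↔ (a, c, b) ∈ M.2.2 := by
  obtain ⟨⟨hP, -⟩, hf, -⟩ := h
  constructor <;> intro h <;> simpa [hf] using (hP _ _ _ h).1

theorem swap_outer (h : IsSymmIntegral M e) (a b c : Fin n) :
    (a, b, c) ∈ M.2.2 ↔ (c, b, a) ∈ M.2.2 := by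
  obtain ⟨⟨hP, -⟩, hf, -⟩ := h
  constructor <;> intro h <;> simpa [hf] using (hP _ _ _ h).2

theorem swap_left (h : IsSymmIntegral M e) (a b c : Fin n) :
    (a, b, c) ∈ M.2.2 ↔ (b, a, c) ∈ M.2.2 := by
  rw [h.swap_right, h.swap_outer, h.swap_right]

theorem mem_mid (h : IsSymmIntegral M e) (a b : Fin n) : (a, e, b) ∈ M.2.2 ↔ a = b := by
  rw [h.1.2 a b, h.2.2]; simp

theorem mem_left (h : IsSymmIntegral M e) (a b : Fin n) : (e, a, b) ∈ M.2.2 ↔ a = b := by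
  rw [h.swap_left, h.mem_mid]

theorem mem_right (h : IsSymmIntegral M e) (a b : Fin n) : (a, b, e) ∈ M.2.2 ↔ a = b := by
  rw [h.swap_right, h.mem_mid]

theorem mem_iff_of_sym2_eq (h : IsSymmIntegral M e) {a b a' b' : Fin n} (hs : s(a, b) = s(a', b'))
    (c : Fin n) : (a, b, c) ∈ M.2.2 ↔ (a', b', c) ∈ M.2.2 := by
  rcases Sym2.eq_iff.1 hs with ⟨rfl, rfl⟩ | ⟨rfl, rfl⟩
  · rfl
  · exact h.swap_left _ _ _

end IsSymmIntegral

theorem PartialIso.symm {n m k : ℕ} {M : FASData n} {e : Fin n} {M' : FASData m} {e' : Fin m}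
    {v : Fin k → Fin n} {w : Fin k → Fin m} (h : PartialIso M e M' e' v w) :
    PartialIso M' e' M e w v :=
  ⟨fun i => (h.1 i).symm, fun i j => (h.2.1 i j).symm, fun i j l => (h.2.2 i j l).symm⟩

theorem PartialIso.snoc_eq_snoc_iff {n m k : ℕ} {M : FASData n} {e : Fin n} {M' : FASData m}
    {e' : Fin m} {v : Fin k → Fin n} {w : Fin k → Fin m} (h : PartialIso M e M' e' v w)
    {a : Fin n} {b : Fin m} (hq : ∀ i, v i = a ↔ w i = b) (i j : Fin (k + 1)) :
    (Fin.snoc v a : Fin (k + 1) → Fin n) i = (Fin.snoc v a : Fin (k + 1) → Fin n) j ↔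
      (Fin.snoc w b : Fin (k + 1) → Fin m) i = (Fin.snoc w b : Fin (k + 1) → Fin m) j := by
  induction i using Fin.lastCases with
  | last =>
    induction j using Fin.lastCases with
    | last => simp
    | cast j => simpa [eq_comm] using hq j
  | cast i =>
    induction j using Fin.lastCases with
    | last => simpa using hq i
    | cast j => simpa using h.2.1 i j

/-- A tuple extended by an element is matched as soon as equalities, identity and the triples
containing the new element are matched. -/
theorem PartialIso.snoc {n m k : ℕ} {M : FASData n} {e : Fin n} {M' : FASData m} {e' : Fin m}
    (hM : IsSymmIntegral M e) (hM' : IsSymmIntegral M' e')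
    {v : Fin k → Fin n} {w : Fin k → Fin m} (h : PartialIso M e M' e' v w) {a : Fin n} {b : Fin m}
    (he : a = e ↔ b = e') (hq : ∀ i, v i = a ↔ w i = b)
    (hT : ∀ i j, ((Fin.snoc v a : Fin (k + 1) → Fin n) i, (Fin.snoc v a : Fin (k + 1) → Fin n) j, a)
        ∈ M.2.2 ↔
      ((Fin.snoc w b : Fin (k + 1) → Fin m) i, (Fin.snoc w b : Fin (k + 1) → Fin m) j, b)
        ∈ M'.2.2) :
    PartialIso M e M' e' (Fin.snoc v a : Fin (k + 1) → Fin n)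
      (Fin.snoc w b : Fin (k + 1) → Fin m) := by
  refine ⟨?_, h.snoc_eq_snoc_iff hq, ?_⟩
  · intro i
    induction i using Fin.lastCases with
    | last => simpa using he
    | cast i => simpa using h.1 i
  · intro i j l
    induction l using Fin.lastCases with
    | last => simpa using hT i j
    | cast l =>
      induction i using Fin.lastCases with
      | last =>
        rw [hM.swap_outer, hM'.swap_outer]
        simpa using hT l.castSucc j
      | cast i =>
        induction j using Fin.lastCases with
        | last =>
          rw [hM.swap_right, hM'.swap_right]
          simpa using hT i.castSucc l.castSucc
        | cast j => simpa using h.2.2 i j l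

theorem PartialIso.exists_snoc {n m k : ℕ} {M : FASData n} {e : Fin n} {M' : FASData m}
    {e' : Fin m} (hM : IsSymmIntegral M e) (hM' : IsSymmIntegral M' e')
    {v : Fin k → Fin n} {w : Fin k → Fin m} (h : PartialIso M e M' e' v w)
    (hext : HasExtension k M' e') (a : Fin n) :
    ∃ b, PartialIso M e M' e' (Fin.snoc v a : Fin (k + 1) → Fin n)
      (Fin.snoc w b : Fin (k + 1) → Fin m) := by
  classical
  by_cases hae : a = e
  · subst hae
    have hq : ∀ i, v i = a ↔ w i = e' := h.1
    refine ⟨e', h.snoc hM hM' (by simp) hq fun i j => ?_⟩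
    rw [hM.mem_right, hM'.mem_right]
    exact h.snoc_eq_snoc_iff hq i j
  by_cases hav : ∃ l, v l = a
  · obtain ⟨l, rfl⟩ := hav
    refine ⟨w l, h.snoc hM hM' (h.1 l) (fun i => h.2.1 i l) fun i j => ?_⟩
    induction i using Fin.lastCases with
    | last =>
      induction j using Fin.lastCases with
      | last => simpa using h.2.2 l l l
      | cast j => simpa using h.2.2 l j l
    | cast i =>
      induction j using Fin.lastCases with
      | last => simpa using h.2.2 i l l
      | cast j => simpa using h.2.2 i j l
  push Not at hav
  obtain ⟨b, hbe, hbw, hb⟩ := hext w (Finset.univ.filter fun p =>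
    ((Fin.snoc v a : Fin (k + 1) → Fin n) p.1, (Fin.snoc v a : Fin (k + 1) → Fin n) p.2, a) ∈ M.2.2)
  have hq : ∀ i, v i = a ↔ w i = b := fun i => iff_of_false (hav i) (hbw i)
  have hqe : ∀ i, (Fin.snoc v a : Fin (k + 1) → Fin n) i = e ↔
      (Fin.snoc w b : Fin (k + 1) → Fin m) i = e' := by
    intro i
    induction i using Fin.lastCases with
    | last => simp [hae, hbe]
    | cast i => simpa using h.1 i
  refine ⟨b, h.snoc hM hM' (iff_of_false hae hbe) hq fun i j => ?_⟩
  have hlast : (Fin.snoc v a : Fin (k + 1) → Fin n) (Fin.last k) = a := by simp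
  have hlast' : (Fin.snoc w b : Fin (k + 1) → Fin m) (Fin.last k) = b := by simp
  have key := h.snoc_eq_snoc_iff hq
  have hb' := hb i j
  generalize (Fin.snoc v a : Fin (k + 1) → Fin n) = V at *
  generalize (Fin.snoc w b : Fin (k + 1) → Fin m) = W at *
  by_cases hi : W i = e'
  · rw [hi, (hqe i).2 hi, hM.mem_left, hM'.mem_left, ← hlast, ← hlast']
    exact key _ _
  by_cases hj : W j = e'
  · rw [hj, (hqe j).2 hj, hM.mem_mid, hM'.mem_mid, ← hlast, ← hlast']
    exact key _ _
  rw [hb' hi hj]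
  constructor
  · intro hT
    exact ⟨(i, j), by simpa using hT, rfl⟩
  · rintro ⟨⟨i', j'⟩, hp, hs⟩
    have hs' : s(V i', V j') = s(V i, V j) := by
      simpa only [Sym2.eq_iff, key] using hs
    exact (hM.mem_iff_of_sym2_eq hs' a).1 (by simpa using hp)

theorem exists_realize_term_eq {α : Type} (t : fasLang.Term α) :
    ∃ x : α, ∀ {n : ℕ} (M : FASData n), M.1 = id → ∀ v : α → Fin n,
      @Language.Term.realize fasLang (Fin n) (toStructure M) α v t = v x := by
  induction t with
  | var x => exact ⟨x, fun _ _ _ => rfl⟩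
  | func F ts ih =>
    cases F with
    | f =>
      obtain ⟨x, hx⟩ := ih 0
      refine ⟨x, fun M hM v => ?_⟩
      let := toStructure M
      change M.1 ((ts 0).realize v) = v x
      rw [hM, hx M hM v, id]

theorem exists_realize_iff {k : ℕ} (φ : fasLang.BoundedFormula Empty k) :
    ∃ K : ℕ, ∀ {n m : ℕ} {M : FASData n} {e : Fin n} {M' : FASData m} {e' : Fin m},
      IsSymmIntegral M e → IsSymmIntegral M' e' →
      (∀ k < K, HasExtension k M e) → (∀ k < K, HasExtension k M' e') →
      ∀ (x : Empty → Fin n) (x' : Empty → Fin m) (v : Fin k → Fin n) (w : Fin k → Fin m),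
        PartialIso M e M' e' v w →
        (@Language.BoundedFormula.Realize fasLang (Fin n) (toStructure M) Empty k φ x v ↔
          @Language.BoundedFormula.Realize fasLang (Fin m) (toStructure M') Empty k φ x' w) := by
  have term_var : ∀ {k : ℕ} (t : fasLang.Term (Empty ⊕ Fin k)),
      ∃ i : Fin k, ∀ {n : ℕ} (M : FASData n), M.1 = id →
        ∀ (x : Empty → Fin n) (v : Fin k → Fin n),
        @Language.Term.realize fasLang (Fin n) (toStructure M) _ (Sum.elim x v) t = v i := by
    intro k t
    obtain ⟨i | i, hi⟩ := exists_realize_term_eq t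
    · exact i.elim
    · exact ⟨i, fun M hM x v => hi M hM _⟩
  induction φ with
  | falsum => exact ⟨0, fun _ _ _ _ _ _ _ _ _ => Iff.rfl⟩
  | equal t₁ t₂ =>
    obtain ⟨i, hi⟩ := term_var t₁
    obtain ⟨j, hj⟩ := term_var t₂
    refine ⟨0, fun {n m M e M' e'} hM hM' _ _ x x' v w h => ?_⟩
    simp only [Language.BoundedFormula.Realize, hi M hM.2.1, hj M hM.2.1, hi M' hM'.2.1,
      hj M' hM'.2.1]
    exact h.2.1 i j
  | rel R ts =>
    choose g hg using fun l => term_var (ts l)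
    refine ⟨0, fun {n m M e M' e'} hM hM' _ _ x x' v w h => ?_⟩
    simp only [Language.BoundedFormula.Realize, hg _ M hM.2.1, hg _ M' hM'.2.1]
    cases R with
    | i =>
      change v (g 0) ∈ M.2.1 ↔ w (g 0) ∈ M'.2.1
      rw [hM.2.2, hM'.2.2]
      simpa using h.1 (g 0)
    | t => exact h.2.2 (g 0) (g 1) (g 2)
  | imp φ ψ ihφ ihψ =>
    obtain ⟨K₁, h₁⟩ := ihφ
    obtain ⟨K₂, h₂⟩ := ihψ
    refine ⟨max K₁ K₂, fun hM hM' hE hE' x x' v w h => ?_⟩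
    exact imp_congr
      (h₁ hM hM' (fun k hk => hE k (lt_max_of_lt_left hk))
        (fun k hk => hE' k (lt_max_of_lt_left hk)) x x' v w h)
      (h₂ hM hM' (fun k hk => hE k (lt_max_of_lt_right hk))
        (fun k hk => hE' k (lt_max_of_lt_right hk)) x x' v w h)
  | @all k φ ih =>
    obtain ⟨K, hK⟩ := ih
    refine ⟨max K (k + 1), fun {n m M e M' e'} hM hM' hE hE' x x' v w h => ?_⟩
    have hφ := fun a b => hK hM hM' (fun k hk => hE k (lt_max_of_lt_left hk))
        (fun k hk => hE' k (lt_max_of_lt_left hk)) x x' (Fin.snoc v a) (Fin.snoc w b)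
    have hk : k < max K (k + 1) := lt_max_of_lt_right (Nat.lt_succ_self k)
    constructor
    · intro hr b
      obtain ⟨a, ha⟩ := h.symm.exists_snoc hM' hM (hE k hk) b
      exact (hφ a b ha.symm).1 (hr a)
    · intro hr a
      obtain ⟨b, hb⟩ := h.exists_snoc hM hM' (hE' k hk) a
      exact (hφ a b hb).2 (hr b)

/-- The number of subsets of `S` that differ from a prescribed pattern on each of a family of
pairwise disjoint cells. -/
theorem card_filter_forall_inter_ne_le {X β : Type*} [DecidableEq X] [DecidableEq β]
    (S : Finset X) (c A : β → Finset X) (m : ℕ) (hA : ∀ b, A b ⊆ c b)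
    (hcS : ∀ b, c b ⊆ S) (hm : ∀ b, (c b).card ≤ m) (B : Finset β)
    (hdisj : ∀ b ∈ B, ∀ b' ∈ B, b ≠ b' → Disjoint (c b) (c b')) :
    ((S.powerset.filter fun R => ∀ b ∈ B, R ∩ c b ≠ A b).card : ℝ) ≤
      2 ^ S.card * (1 - (1 / 2) ^ m) ^ B.card := by
  induction B using Finset.induction_on with
  | empty => simp
  | insert b B hb ih =>
    specialize ih fun x hx y hy =>
      hdisj x (Finset.mem_insert_of_mem hx) y (Finset.mem_insert_of_mem hy)
    set P := S.powerset.filter fun R => ∀ b ∈ B, R ∩ c b ≠ A b with hP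
    have hsplit : (S.powerset.filter fun R => ∀ x ∈ insert b B, R ∩ c x ≠ A x) =
        P.filter fun R => ¬ R ∩ c b = A b := by
      ext R
      simp only [hP, Finset.mem_filter, Finset.forall_mem_insert]
      tauto
    have hinj : P.card ≤ ((P.filter fun R => R ∩ c b = A b) ×ˢ (c b).powerset).card := by
      refine Finset.card_le_card_of_injOn (fun R => ((R \ c b) ∪ A b, R ∩ c b)) ?_ ?_
      · intro R hR
        simp only [hP, Finset.coe_filter, Set.mem_ofPred_eq, Finset.mem_powerset] at hR
        simp only [Finset.coe_product, Set.mem_prod, Finset.mem_coe, Finset.mem_filter, hP,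
          Finset.mem_powerset]
        refine ⟨⟨⟨?_, ?_⟩, ?_⟩, Finset.inter_subset_right⟩
        · exact Finset.union_subset (Finset.sdiff_subset.trans hR.1) ((hA b).trans (hcS b))
        · intro x hx heq
          apply hR.2 x hx
          have hd : Disjoint (c b) (c x) :=
            hdisj b (Finset.mem_insert_self _ _) x (Finset.mem_insert_of_mem hx)
              (fun h => hb (h ▸ hx))
          rw [← heq]
          ext t
          have h1 : t ∈ c b → t ∉ c x := fun h h' => Finset.disjoint_left.1 hd h h'
          have h2 := @hA b t
          simp only [Finset.mem_inter, Finset.mem_union, Finset.mem_sdiff]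
          tauto
        · ext t
          have h2 := @hA b t
          simp only [Finset.mem_inter, Finset.mem_union, Finset.mem_sdiff]
          tauto
      · intro R _ R' _ h
        simp only [Prod.mk.injEq] at h
        obtain ⟨h1, h2⟩ := h
        ext t
        have h1 := Finset.ext_iff.1 h1 t
        have h2 := Finset.ext_iff.1 h2 t
        have h3 := @hA b t
        simp only [Finset.mem_inter, Finset.mem_union, Finset.mem_sdiff] at h1 h2
        tauto
    have hcard := Finset.card_filter_add_card_filter_not (s := P) (fun R => R ∩ c b = A b)
    rw [hsplit, Finset.card_insert_of_notMem hb]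
    rw [Finset.card_product, Finset.card_powerset] at hinj
    have hpow : (2 : ℕ) ^ (c b).card ≤ 2 ^ m := Nat.pow_le_pow_right (by norm_num) (hm b)
    have hinj' : (P.card : ℝ) ≤ (P.filter fun R => R ∩ c b = A b).card * 2 ^ m := by
      exact_mod_cast hinj.trans (Nat.mul_le_mul_left _ hpow)
    have hcard' : ((P.filter fun R => R ∩ c b = A b).card : ℝ) +
        (P.filter fun R => ¬ R ∩ c b = A b).card = P.card := by exact_mod_cast hcard
    have hhalf : (P.card : ℝ) * (1 / 2) ^ m ≤ (P.filter fun R => R ∩ c b = A b).card := by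
      rw [one_div, inv_pow, ← div_eq_mul_inv, div_le_iff₀ (by positivity)]
      exact hinj'
    have hle : (0 : ℝ) ≤ 1 - (1 / 2) ^ m := by
      have : ((1 : ℝ) / 2) ^ m ≤ 1 := pow_le_one₀ (by norm_num) (by norm_num)
      linarith
    calc ((P.filter fun R => ¬ R ∩ c b = A b).card : ℝ) ≤ P.card * (1 - (1 / 2) ^ m) := by
          linarith
      _ ≤ (2 ^ S.card * (1 - (1 / 2) ^ m) ^ B.card) * (1 - (1 / 2) ^ m) := by gcongr
      _ = _ := by ring

theorem mem_symTriple {α : Type*} {a b c x : α} :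
    x ∈ symTriple a b c ↔ x = a ∨ x = b ∨ x = c := by
  simp [symTriple]

theorem symTriple_swap_left {α : Type*} (a b c : α) : symTriple a b c = symTriple b a c :=
  Sym.cons_swap _ _ _

theorem symTriple_swap_right {α : Type*} (a b c : α) : symTriple a b c = symTriple a c b := by
  simp only [symTriple, Sym.cons_swap b c]

theorem symTriple_left_inj {α : Type*} {a b c b' c' : α} :
    symTriple a b c = symTriple a b' c' ↔ s(b, c) = s(b', c') := by
  constructor
  · intro h
    have h := Sym.cons_inj_right _ _ _ |>.1 h
    have hb : b ∈ b' ::ₛ c' ::ₛ Sym.nil := by rw [← h]; simp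
    simp only [Sym.mem_cons, Sym.notMem_nil, or_false] at hb
    rcases hb with rfl | rfl
    · have h := Sym.cons_inj_right _ _ _ |>.1 h
      have hc : c ∈ c' ::ₛ Sym.nil := by rw [← h]; simp
      simp only [Sym.mem_cons, Sym.notMem_nil, or_false] at hc
      rw [hc]
    · rw [Sym.cons_swap b'] at h
      have h := Sym.cons_inj_right _ _ _ |>.1 h
      have hc : c ∈ b' ::ₛ Sym.nil := by rw [← h]; simp
      simp only [Sym.mem_cons, Sym.notMem_nil, or_false] at hc
      rw [hc, Sym2.eq_swap]
  · intro h
    rcases Sym2.eq_iff.1 h with ⟨rfl, rfl⟩ | ⟨rfl, rfl⟩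
    · rfl
    · exact symTriple_swap_right _ _ _

theorem symTriple_right_inj {α : Type*} {a b c a' b' : α} :
    symTriple a b c = symTriple a' b' c ↔ s(a, b) = s(a', b') := by
  rw [symTriple_swap_right, symTriple_swap_left, symTriple_swap_right a', symTriple_swap_left a',
    symTriple_left_inj]

theorem exists_eq_symTriple {α : Type*} (t : Sym α 3) : ∃ a b c, t = symTriple a b c := by
  obtain ⟨a, t, rfl⟩ := Sym.exists_eq_cons_of_succ t
  obtain ⟨b, t, rfl⟩ := Sym.exists_eq_cons_of_succ t
  obtain ⟨c, t, rfl⟩ := Sym.exists_eq_cons_of_succ t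
  exact ⟨a, b, c, by rw [Sym.eq_nil_of_card_zero t]; rfl⟩

/-- The three-element multisets avoiding `e`. -/
def symAvoiding {n : ℕ} (e : Fin n) : Finset (Sym (Fin n) 3) :=
  Finset.univ.image (Sym.map (Subtype.val : {x : Fin n // x ≠ e} → Fin n))

theorem symTriple_mem_symAvoiding {n : ℕ} {e a b c : Fin n} :
    symTriple a b c ∈ symAvoiding e ↔ a ≠ e ∧ b ≠ e ∧ c ≠ e := by
  constructor
  · intro h
    obtain ⟨t, -, ht⟩ := Finset.mem_image.1 h
    have key : ∀ x ∈ symTriple a b c, x ≠ e := by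
      intro x hx
      rw [← ht, Sym.mem_map] at hx
      obtain ⟨y, -, rfl⟩ := hx
      exact y.2
    exact ⟨key _ (by simp [mem_symTriple]), key _ (by simp [mem_symTriple]),
      key _ (by simp [mem_symTriple])⟩
  · rintro ⟨ha, hb, hc⟩
    exact Finset.mem_image.2 ⟨symTriple ⟨a, ha⟩ ⟨b, hb⟩ ⟨c, hc⟩, Finset.mem_univ _, rfl⟩

theorem card_symAvoiding {n : ℕ} (e : Fin n) : (symAvoiding e).card = (n + 1).choose 3 := by
  rw [symAvoiding, Finset.card_image_of_injective _ (Sym.map_injective Subtype.val_injective _),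
    Finset.card_univ, Sym.card_sym_eq_choose, Fintype.card_subtype_compl, Fintype.card_fin]
  have : 0 < n := e.pos
  simp only [Fintype.card_subtype_eq]
  congr 1
  omega

/-- The symmetric integral structure with identity `e` and non-identity triples given by `R`. -/
def fasOfSym {n : ℕ} (e : Fin n) (R : Finset (Sym (Fin n) 3)) : FASData n :=
  (id, {e}, Finset.univ.filter fun t => (t.1 = e ∧ t.2.1 = t.2.2) ∨ (t.2.1 = e ∧ t.1 = t.2.2) ∨
    (t.2.2 = e ∧ t.1 = t.2.1) ∨ symTriple t.1 t.2.1 t.2.2 ∈ R)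

theorem mem_fasOfSym {n : ℕ} {e : Fin n} {R : Finset (Sym (Fin n) 3)} {a b c : Fin n} :
    (a, b, c) ∈ (fasOfSym e R).2.2 ↔ (a = e ∧ b = c) ∨ (b = e ∧ a = c) ∨ (c = e ∧ a = b) ∨
      symTriple a b c ∈ R := by
  simp [fasOfSym]

theorem mem_fasOfSym_of_ne {n : ℕ} {e : Fin n} {R : Finset (Sym (Fin n) 3)} {a b c : Fin n}
    (ha : a ≠ e) (hb : b ≠ e) (hc : c ≠ e) :
    (a, b, c) ∈ (fasOfSym e R).2.2 ↔ symTriple a b c ∈ R := by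
  simp [mem_fasOfSym, ha, hb, hc]

theorem isFAS_fasOfSym {n : ℕ} {e : Fin n} {R : Finset (Sym (Fin n) 3)} (hR : R ⊆ symAvoiding e) :
    IsFAS (fasOfSym e R) := by
  refine ⟨fun a b c h => ⟨?_, ?_⟩, fun a b => ?_⟩
  · change (a, c, b) ∈ _
    rw [mem_fasOfSym] at *
    rw [symTriple_swap_right a c b]
    grind
  · change (c, b, a) ∈ _
    rw [mem_fasOfSym] at *
    rw [symTriple_swap_left, symTriple_swap_right, symTriple_swap_left]
    grind
  · have : symTriple a e b ∉ R := fun h => (symTriple_mem_symAvoiding.1 (hR h)).2.1 rfl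
    change a = b ↔ ∃ i ∈ ({e} : Finset (Fin n)), _
    simp only [Finset.mem_singleton, exists_eq_left, mem_fasOfSym, this]
    grind

theorem fasOfSym_injective {n : ℕ} {e e' : Fin n} {R R' : Finset (Sym (Fin n) 3)}
    (hR : R ⊆ symAvoiding e) (hR' : R' ⊆ symAvoiding e') (h : fasOfSym e R = fasOfSym e' R') :
    e = e' ∧ R = R' := by
  have he : ({e} : Finset (Fin n)) = {e'} := congrArg (fun M => M.2.1) h
  rw [Finset.singleton_inj] at he
  subst he
  refine ⟨rfl, ?_⟩
  ext t
  obtain ⟨a, b, c, rfl⟩ := exists_eq_symTriple t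
  by_cases ht : symTriple a b c ∈ symAvoiding e
  · obtain ⟨ha, hb, hc⟩ := symTriple_mem_symAvoiding.1 ht
    rw [← mem_fasOfSym_of_ne ha hb hc, ← mem_fasOfSym_of_ne ha hb hc, h]
  · exact iff_of_false (fun h => ht (hR h)) (fun h => ht (hR' h))

theorem IsSymmIntegral.mem_iff_of_symTriple_eq {n : ℕ} {M : FASData n} {e : Fin n}
    (h : IsSymmIntegral M e) {a b c a' b' c' : Fin n}
    (ht : symTriple a b c = symTriple a' b' c') : (a, b, c) ∈ M.2.2 ↔ (a', b', c') ∈ M.2.2 := by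
  have hc : c ∈ symTriple a' b' c' := by rw [← ht]; simp [mem_symTriple]
  rcases mem_symTriple.1 hc with rfl | rfl | rfl
  · rw [symTriple_swap_left c, symTriple_swap_right b'] at ht
    rw [h.mem_iff_of_sym2_eq (symTriple_right_inj.1 ht), h.swap_right, h.swap_left]
  · rw [symTriple_swap_right a'] at ht
    rw [h.mem_iff_of_sym2_eq (symTriple_right_inj.1 ht), h.swap_right]
  · exact h.mem_iff_of_sym2_eq (symTriple_right_inj.1 ht) _

theorem IsSymmIntegral.exists_eq_fasOfSym {n : ℕ} {M : FASData n} {e : Fin n}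
    (h : IsSymmIntegral M e) : ∃ R ⊆ symAvoiding e, M = fasOfSym e R := by
  classical
  refine ⟨(symAvoiding e).filter fun t => ∃ a b c, t = symTriple a b c ∧ (a, b, c) ∈ M.2.2,
    Finset.filter_subset _ _, Prod.ext h.2.1 (Prod.ext h.2.2 ?_)⟩
  ext ⟨a, b, c⟩
  rw [mem_fasOfSym, Finset.mem_filter, symTriple_mem_symAvoiding]
  by_cases ha : a = e
  · subst ha; rw [h.mem_left]; grind
  by_cases hb : b = e
  · subst hb; rw [h.mem_mid]; grind
  by_cases hc : c = e
  · subst hc; rw [h.mem_right]; grind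
  simp only [ha, hb, hc, false_and, false_or, ne_eq, not_false_eq_true, true_and]
  exact ⟨fun hT => ⟨a, b, c, rfl, hT⟩,
    fun ⟨_, _, _, ht, hT⟩ => (h.mem_iff_of_symTriple_eq ht).2 hT⟩

theorem mul_two_pow_le_card_isFAS (n : ℕ) :
    n * 2 ^ (n + 1).choose 3 ≤ Nat.card {M : FASData n // IsFAS M} := by
  classical
  have hcard : (Finset.univ.sigma fun e : Fin n => (symAvoiding e).powerset).card =
      n * 2 ^ (n + 1).choose 3 := by
    simp [Finset.card_sigma, card_symAvoiding]
  rw [← hcard, Nat.card_eq_fintype_card, Fintype.card_subtype]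
  refine Finset.card_le_card_of_injOn (fun p => fasOfSym p.1 p.2) ?_ ?_
  · rintro ⟨e, R⟩ h
    simp only [Finset.coe_sigma, Set.mem_sigma_iff, Finset.mem_coe, Finset.mem_powerset] at h
    simpa using isFAS_fasOfSym h.2
  · rintro ⟨e, R⟩ h ⟨e', R'⟩ h' heq
    simp only [Finset.coe_sigma, Set.mem_sigma_iff, Finset.mem_coe, Finset.mem_powerset] at h h'
    obtain ⟨rfl, rfl⟩ := fasOfSym_injective h.2 h'.2 heq
    rfl

open Classical in
theorem card_not_hasExtension_le (n k : ℕ) :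
    ((Finset.univ.filter fun M : FASData n =>
      ∃ e, IsSymmIntegral M e ∧ ¬ HasExtension k M e).card : ℝ) ≤
      (n * 2 ^ (n + 1).choose 3) * (n ^ k * 2 ^ ((k + 1) * (k + 1)) *
        (1 - (1 / 2) ^ ((k + 1) * (k + 1))) ^ (n - (k + 1))) := by
  set ι := Fin n × (Fin k → Fin n) × Finset (Fin (k + 1) × Fin (k + 1))
  let W : (Fin k → Fin n) → Fin n → Fin (k + 1) → Fin n := fun w b => Fin.snoc w b
  let tr : (Fin k → Fin n) → Fin n → Fin (k + 1) × Fin (k + 1) → Sym (Fin n) 3 :=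
    fun w b p => symTriple (W w b p.1) (W w b p.2) b
  let c : ι → Fin n → Finset (Sym (Fin n) 3) := fun q b =>
    Finset.univ.image (tr q.2.1 b) ∩ symAvoiding q.1
  let A : ι → Fin n → Finset (Sym (Fin n) 3) := fun q b =>
    q.2.2.image (tr q.2.1 b) ∩ symAvoiding q.1
  let B : ι → Finset (Fin n) := fun q => Finset.univ \ insert q.1 (Finset.univ.image q.2.1)
  let P : ι → Finset (Finset (Sym (Fin n) 3)) := fun q =>
    (symAvoiding q.1).powerset.filter fun R => ∀ b ∈ B q, R ∩ c q b ≠ A q b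
  have hB : ∀ q b, b ∈ B q ↔ b ≠ q.1 ∧ ∀ i, q.2.1 i ≠ b := by
    intro q b
    simp [B]
  have hmW : ∀ w b i, W w b i = b ∨ ∃ j, W w b i = w j := by
    intro w b i
    induction i using Fin.lastCases with
    | last => simp [W]
    | cast i => right; exact ⟨i, by simp [W]⟩
  have hPcard : ∀ q, ((P q).card : ℝ) ≤ 2 ^ (n + 1).choose 3 *
      (1 - (1 / 2) ^ ((k + 1) * (k + 1))) ^ (n - (k + 1)) := by
    intro q
    have hle1 : ((1 : ℝ) / 2) ^ ((k + 1) * (k + 1)) ≤ 1 :=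
      pow_le_one₀ (by norm_num) (by norm_num)
    have hpos : (0 : ℝ) ≤ (1 / 2) ^ ((k + 1) * (k + 1)) := by positivity
    have hP := card_filter_forall_inter_ne_le (symAvoiding q.1) (c q) (A q) ((k + 1) * (k + 1))
      ?_ ?_ ?_ (B q) ?_
    · have hP' : ((P q).card : ℝ) ≤ 2 ^ (symAvoiding q.1).card *
          (1 - (1 / 2) ^ ((k + 1) * (k + 1))) ^ (B q).card := by
        convert hP
      refine hP'.trans ?_
      rw [card_symAvoiding]
      refine mul_le_mul_of_nonneg_left ?_ (by positivity)
      refine pow_le_pow_of_le_one (by linarith) (by linarith) ?_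
      have h1 : (insert q.1 (Finset.univ.image q.2.1)).card ≤ k + 1 := by
        refine (Finset.card_insert_le _ _).trans (Nat.succ_le_succ ?_)
        exact Finset.card_image_le.trans (by simp)
      have h2 := Finset.le_card_sdiff (insert q.1 (Finset.univ.image q.2.1))
        (Finset.univ : Finset (Fin n))
      rw [Finset.card_univ, Fintype.card_fin] at h2
      change n - (k + 1) ≤ (Finset.univ \ _).card
      omega
    · exact fun b => Finset.inter_subset_inter_right (Finset.image_subset_image
        (Finset.subset_univ _))
    · exact fun b => Finset.inter_subset_right
    · intro b
      refine (Finset.card_le_card Finset.inter_subset_left).trans (Finset.card_image_le.trans ?_)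
      simp
    · intro b hb b' hb' hne
      rw [Finset.disjoint_left]
      intro t ht ht'
      simp only [c, Finset.mem_inter, Finset.mem_image, Finset.mem_univ, true_and] at ht ht'
      obtain ⟨⟨p, rfl⟩, -⟩ := ht
      obtain ⟨⟨p', hp'⟩, -⟩ := ht'
      have hmem : b' ∈ tr q.2.1 b p := by
        rw [← hp']; simp [tr, mem_symTriple]
      have hw := ((hB _ _).1 hb').2
      simp only [tr, mem_symTriple] at hmem
      rcases hmem with h | h | h
      · rcases hmW q.2.1 b p.1 with h' | ⟨j, h'⟩
        · exact hne (h'.symm.trans h.symm)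
        · exact hw j (h'.symm.trans h.symm)
      · rcases hmW q.2.1 b p.2 with h' | ⟨j, h'⟩
        · exact hne (h'.symm.trans h.symm)
        · exact hw j (h'.symm.trans h.symm)
      · exact hne h.symm
  have hsub : (Finset.univ.filter fun M : FASData n =>
      ∃ e, IsSymmIntegral M e ∧ ¬ HasExtension k M e) ⊆
      (Finset.univ : Finset ι).biUnion fun q => (P q).image (fasOfSym q.1) := by
    intro M hM
    obtain ⟨e, hSI, hext⟩ := (Finset.mem_filter.1 hM).2
    obtain ⟨R, hR, rfl⟩ := hSI.exists_eq_fasOfSym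
    simp only [HasExtension, not_forall] at hext
    obtain ⟨w, Q, hext⟩ := hext
    refine Finset.mem_biUnion.2 ⟨(e, w, Q), Finset.mem_univ _, Finset.mem_image.2 ⟨R, ?_, rfl⟩⟩
    refine Finset.mem_filter.2 ⟨Finset.mem_powerset.2 hR, fun b hb heq => hext ?_⟩
    obtain ⟨hbe, hbw⟩ := (hB _ _).1 hb
    refine ⟨b, hbe, hbw, fun i j hi hj => ?_⟩
    rw [mem_fasOfSym_of_ne hi hj hbe]
    have hav : symTriple (W w b i) (W w b j) b ∈ symAvoiding e :=
      symTriple_mem_symAvoiding.2 ⟨hi, hj, hbe⟩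
    have key := Finset.ext_iff.1 heq (symTriple (W w b i) (W w b j) b)
    simp only [c, A, Finset.mem_inter, Finset.mem_image, Finset.mem_univ, true_and, hav,
      and_true, tr, symTriple_right_inj] at key
    rw [← key]
    exact ⟨fun h => ⟨h, (i, j), rfl⟩, fun h => h.1⟩
  have hcardι : (Fintype.card ι : ℝ) = n * (n ^ k * 2 ^ ((k + 1) * (k + 1))) := by
    simp [ι]
  calc ((Finset.univ.filter fun M : FASData n =>
      ∃ e, IsSymmIntegral M e ∧ ¬ HasExtension k M e).card : ℝ)
      ≤ (((Finset.univ : Finset ι).biUnion fun q => (P q).image (fasOfSym q.1)).card : ℝ) := by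
        exact_mod_cast Finset.card_le_card hsub
    _ ≤ ((∑ q : ι, (P q).card : ℕ) : ℝ) := by
        exact_mod_cast Finset.card_biUnion_le.trans
          (Finset.sum_le_sum fun q _ => Finset.card_image_le)
    _ ≤ ∑ q : ι, 2 ^ (n + 1).choose 3 *
          (1 - (1 / 2) ^ ((k + 1) * (k + 1)) : ℝ) ^ (n - (k + 1)) := by
        rw [Nat.cast_sum]
        exact Finset.sum_le_sum fun q _ => hPcard q
    _ = _ := by
        rw [Finset.sum_const, Finset.card_univ, nsmul_eq_mul, hcardι]
        ring

/-- The action of `S₃` on triples in which odd permutations also apply the involution `f`. -/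
@[reducible]
def twistedAction {V : Type*} {f : V → V} (hf : Function.Involutive f) :
    MulAction (Equiv.Perm (Fin 3)) (Fin 3 → V) where
  smul g t := fun i => (if Equiv.Perm.sign g = 1 then id else f) (t (g⁻¹ i))
  one_smul t := by
    funext i
    change (if Equiv.Perm.sign (1 : Equiv.Perm (Fin 3)) = 1 then id else f) _ = _
    simp
  mul_smul g h t := by
    funext i
    change (if Equiv.Perm.sign (g * h) = 1 then id else f) (t ((g * h)⁻¹ i)) =
      (if Equiv.Perm.sign g = 1 then id else f)
        ((if Equiv.Perm.sign h = 1 then id else f) (t (h⁻¹ (g⁻¹ i))))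
    rw [map_mul, mul_inv_rev, Equiv.Perm.mul_apply]
    rcases Int.units_eq_one_or (Equiv.Perm.sign g) with hg | hg <;>
      rcases Int.units_eq_one_or (Equiv.Perm.sign h) with hh | hh <;>
      simp [hg, hh, hf _]

theorem univ_perm_fin_three : (Finset.univ : Finset (Equiv.Perm (Fin 3))) =
    {1, Equiv.swap 0 1, Equiv.swap 0 2, Equiv.swap 1 2, Equiv.swap 0 1 * Equiv.swap 1 2,
      Equiv.swap 1 2 * Equiv.swap 0 1} := by decide

/-- The orbits of triples under the Peircean transformations, counted by Burnside's lemma. -/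
theorem exists_peircean_orbit_map {V : Type} [Fintype V] [DecidableEq V] {f : V → V}
    (hf : Function.Involutive f) :
    ∃ (O : Type) (_ : Fintype O) (q : V → V → V → O),
      6 * Fintype.card O ≤ Fintype.card V ^ 3 +
        3 * (Fintype.card {x : V // f x = x} * Fintype.card V) + 2 * Fintype.card V ∧
      ∀ P : V → V → V → Prop, (∀ a b c, P a b c → P (f a) c b ∧ P c (f b) a) →
        ∀ a b c a' b' c', q a b c = q a' b' c' → P a b c → P a' b' c' := by
  classical
  let := twistedAction hf
  have hsmul : ∀ (g : Equiv.Perm (Fin 3)) (t : Fin 3 → V) (i : Fin 3),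
      (g • t) i = (if Equiv.Perm.sign g = 1 then id else f) (t (g⁻¹ i)) := fun _ _ _ => rfl
  have hodd : ∀ i j l : Fin 3, i ≠ j → (∀ x, x = i ∨ x = j ∨ x = l) → l ≠ i → l ≠ j →
      Fintype.card (MulAction.fixedBy (Fin 3 → V) (Equiv.swap i j)) ≤
        Fintype.card {x : V // f x = x} * Fintype.card V := by
    intro i j l hij hall hli hlj
    have key : ∀ t ∈ MulAction.fixedBy (Fin 3 → V) (Equiv.swap i j), ∀ x,
        t x = f (t (Equiv.swap i j x)) := by
      intro t ht x
      have h := congrFun ht x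
      rw [hsmul, Equiv.Perm.sign_swap hij, Equiv.swap_inv] at h
      simpa using h.symm
    rw [← Fintype.card_prod]
    refine Fintype.card_le_of_injective (fun t => (⟨t.1 l, ?_⟩, t.1 i)) ?_
    · have h := key t.1 t.2 l
      rw [Equiv.swap_apply_of_ne_of_ne hli hlj] at h
      exact h.symm
    · rintro ⟨t, ht⟩ ⟨t', ht'⟩ h
      simp only [Prod.mk.injEq, Subtype.mk.injEq] at h
      refine Subtype.ext (funext fun x => ?_)
      rcases hall x with rfl | rfl | rfl
      · exact h.2
      · have h1 := key t ht x
        have h2 := key t' ht' x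
        rw [Equiv.swap_apply_right] at h1 h2
        exact h1.trans ((congrArg f h.2).trans h2.symm)
      · exact h.1
  have hcyc : ∀ g : Equiv.Perm (Fin 3), Equiv.Perm.sign g = 1 →
      (∀ x, x = 0 ∨ g⁻¹ x = 0 ∨ g⁻¹ (g⁻¹ x) = 0) →
      Fintype.card (MulAction.fixedBy (Fin 3 → V) g) ≤ Fintype.card V := by
    intro g hg hx
    have key : ∀ t ∈ MulAction.fixedBy (Fin 3 → V) g, ∀ x, t x = t (g⁻¹ x) := by
      intro t ht x
      have h := congrFun ht x
      rw [hsmul, hg] at h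
      simpa using h.symm
    have hconst : ∀ t ∈ MulAction.fixedBy (Fin 3 → V) g, ∀ x, t x = t 0 := by
      intro t ht x
      rcases hx x with h | h | h
      · rw [h]
      · rw [key t ht, h]
      · rw [key t ht, key t ht, h]
    refine Fintype.card_le_of_injective (fun t => t.1 0) ?_
    rintro ⟨t, ht⟩ ⟨t', ht'⟩ h
    refine Subtype.ext (funext fun x => ?_)
    exact (hconst t ht x).trans (Eq.trans h (hconst t' ht' x).symm)
  refine ⟨Quotient (MulAction.orbitRel (Equiv.Perm (Fin 3)) (Fin 3 → V)), inferInstance,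
    fun a b c => Quotient.mk _ ![a, b, f c], ?_, ?_⟩
  · have hB := MulAction.sum_card_fixedBy_eq_card_orbits_mul_card_group
      (Equiv.Perm (Fin 3)) (Fin 3 → V)
    have hcard : Fintype.card (Equiv.Perm (Fin 3)) = 6 := by decide
    have hone : Fintype.card (MulAction.fixedBy (Fin 3 → V) (1 : Equiv.Perm (Fin 3))) =
        Fintype.card V ^ 3 := by
      simp [MulAction.fixedBy]
    rw [hcard, univ_perm_fin_three, Finset.sum_insert (by decide), Finset.sum_insert (by decide),
      Finset.sum_insert (by decide), Finset.sum_insert (by decide), Finset.sum_insert (by decide),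
      Finset.sum_singleton, hone] at hB
    have h01 := hodd 0 1 2 (by decide) (by decide) (by decide) (by decide)
    have h02 := hodd 0 2 1 (by decide) (by decide) (by decide) (by decide)
    have h12 := hodd 1 2 0 (by decide) (by decide) (by decide) (by decide)
    have hc := hcyc (Equiv.swap 0 1 * Equiv.swap 1 2) (by decide) (by decide)
    have hc' := hcyc (Equiv.swap 1 2 * Equiv.swap 0 1) (by decide) (by decide)
    omega
  · intro P hP a b c a' b' c' hq h
    obtain ⟨g, hg⟩ := MulAction.orbitRel_apply.1 (Quotient.exact hq.symm)
    replace hg : g • ![a, b, f c] = ![a', b', f c'] := hg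
    have e0 : a' = (g • ![a, b, f c]) 0 := by rw [hg]; rfl
    have e1 : b' = (g • ![a, b, f c]) 1 := by rw [hg]; rfl
    have e2 : c' = f ((g • ![a, b, f c]) 2) := by rw [hg]; exact (hf c').symm
    rw [e0, e1, e2]
    have p1 := hP _ _ _ h
    have p2 := hP _ _ _ p1.1
    have p3 := hP _ _ _ p1.2
    have p4 := hP _ _ _ p3.1
    have hmem := Finset.mem_univ g
    rw [univ_perm_fin_three] at hmem
    simp only [Finset.mem_insert, Finset.mem_singleton] at hmem
    rcases hmem with rfl | rfl | rfl | rfl | rfl | rfl <;>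
      simp [hsmul, Equiv.swap_apply_of_ne_of_ne, hf _] at * <;> tauto

namespace IsFAS

variable {n : ℕ} {M : FASData n}

theorem eq_of_mem (h : IsFAS M) {a b i : Fin n} (hi : i ∈ M.2.1) (ht : (a, i, b) ∈ M.2.2) :
    a = b :=
  (h.2 a b).2 ⟨i, hi, ht⟩

theorem involutive (h : IsFAS M) : Function.Involutive M.1 := by
  intro a
  obtain ⟨i, hi, ht⟩ := (h.2 a a).1 rfl
  exact h.eq_of_mem hi (h.1 _ _ _ (h.1 _ _ _ ht).1).1

theorem map_eq_of_mem (h : IsFAS M) {i : Fin n} (hi : i ∈ M.2.1) : M.1 i = i := by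
  obtain ⟨j, hj, ht⟩ := (h.2 i i).1 rfl
  have hij := h.eq_of_mem hi (h.1 _ _ _ ht).1
  have ht' := (h.1 _ _ _ ht).2
  rw [← hij, h.involutive i] at ht'
  exact h.eq_of_mem hi (h.1 _ _ _ ht').1

theorem map_notMem (h : IsFAS M) {a : Fin n} (ha : a ∉ M.2.1) : M.1 a ∉ M.2.1 := by
  intro hfa
  have := h.map_eq_of_mem hfa
  rw [h.involutive a] at this
  exact ha (this ▸ hfa)

/-- Membership of a triple containing an identity element reduces to a triple `(x, i, x)`. -/
theorem mem_iff (h : IsFAS M) (a b c : Fin n) :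
    (b ∈ M.2.1 → ((a, b, c) ∈ M.2.2 ↔ a = c ∧ (a, b, a) ∈ M.2.2)) ∧
    (c ∈ M.2.1 → ((a, b, c) ∈ M.2.2 ↔ M.1 a = b ∧ (b, c, b) ∈ M.2.2)) ∧
    (a ∈ M.2.1 → ((a, b, c) ∈ M.2.2 ↔ b = c ∧ (M.1 b, a, M.1 b) ∈ M.2.2)) := by
  have hf := h.involutive
  refine ⟨fun hb => ⟨fun ht => ?_, ?_⟩, fun hc => ⟨fun ht => ?_, ?_⟩,
    fun ha => ⟨fun ht => ?_, ?_⟩⟩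
  · obtain rfl := h.eq_of_mem hb ht
    exact ⟨rfl, ht⟩
  · rintro ⟨rfl, ht⟩
    exact ht
  · have ht' := (h.1 _ _ _ ht).1
    obtain rfl := h.eq_of_mem hc ht'
    exact ⟨rfl, ht'⟩
  · rintro ⟨rfl, ht⟩
    have ht' := (h.1 _ _ _ ht).1
    rwa [hf a] at ht'
  · have hfa := h.map_eq_of_mem ha
    have ht' := (h.1 _ _ _ (h.1 _ _ _ (h.1 _ _ _ ht).1).2).1
    rw [hfa] at ht'
    have hbc := h.eq_of_mem ha ht'
    exact ⟨hf.injective hbc, by rwa [← hbc] at ht'⟩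
  · rintro ⟨rfl, ht⟩
    have ht' := (h.1 _ _ _ (h.1 _ _ _ ht).1).2
    simpa only [hf b, h.map_eq_of_mem ha] using ht'

/-- A FAS structure is determined by `f`, `I`, the triples `(a, i, a)` with `i ∈ I` and the
triples that avoid `I`. -/
theorem ext_of_mem_iff {f : Fin n → Fin n} {I : Finset (Fin n)}
    {T T' : Finset (Fin n × Fin n × Fin n)} (h : IsFAS (f, I, T)) (h' : IsFAS (f, I, T'))
    (hI : ∀ a, ∀ i ∈ I, (a, i, a) ∈ T ↔ (a, i, a) ∈ T')
    (hV : ∀ a b c, a ∉ I → b ∉ I → c ∉ I → ((a, b, c) ∈ T ↔ (a, b, c) ∈ T')) : T = T' := by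
  ext ⟨a, b, c⟩
  obtain ⟨h1, h2, h3⟩ := h.mem_iff a b c
  obtain ⟨h1', h2', h3'⟩ := h'.mem_iff a b c
  by_cases ha : a ∈ I
  · exact (h3 ha).trans ((and_congr_right fun _ => hI _ _ ha).trans (h3' ha).symm)
  by_cases hb : b ∈ I
  · exact (h1 hb).trans ((and_congr_right fun _ => hI _ _ hb).trans (h1' hb).symm)
  by_cases hc : c ∈ I
  · exact (h2 hc).trans ((and_congr_right fun _ => hI _ _ hc).trans (h2' hc).symm)
  exact hV a b c ha hb hc

end IsFAS

open Classical in
/-- Upper bounds for the number of FAS structures with prescribed `f` and `I`. -/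
theorem exists_card_isFAS_le {n : ℕ} (f : Fin n → Fin n) (I : Finset (Fin n))
    (hne : ∃ T, IsFAS (f, I, T)) :
    ∃ m : ℕ, 6 * m + 3 * ((Finset.univ.filter fun x => f x ≠ x).card * (n - I.card)) ≤
        (n - I.card) * (n - I.card + 1) * (n - I.card + 2) ∧
      (Finset.univ.filter fun T => IsFAS (f, I, T)).card ≤ 2 ^ (n * I.card + m) ∧
      (I.card = 1 → (Finset.univ.filter fun T => IsFAS (f, I, T)).card ≤ 2 ^ m) := by
  obtain ⟨T₀, h₀⟩ := hne
  have hfI : ∀ x ∈ I, f x = x := fun x hx => h₀.map_eq_of_mem hx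
  have hff : Function.Involutive f := h₀.involutive
  let g : {x // x ∉ I} → {x // x ∉ I} := fun x => ⟨f x, h₀.map_notMem x.2⟩
  have hg : Function.Involutive g := fun x => Subtype.ext (hff x)
  obtain ⟨O, _, q, hO, hq⟩ := exists_peircean_orbit_map hg
  have hN : Fintype.card {x // x ∉ I} = n - I.card := by
    rw [Fintype.card_subtype_compl]; simp
  have hs : Fintype.card {x // g x = x} + (Finset.univ.filter fun x => f x ≠ x).card ≤
      n - I.card := by
    have h1 : (Finset.univ.filter fun x => f x ≠ x).card = Fintype.card {x // ¬ g x = x} := by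
      rw [← Fintype.card_subtype]
      refine Fintype.card_congr ⟨fun x => ⟨⟨x.1, fun hx => x.2 (hfI _ hx)⟩, fun hx => x.2
        (congrArg Subtype.val hx)⟩, fun x => ⟨x.1.1, fun hx => x.2 (Subtype.ext hx)⟩,
        fun _ => rfl, fun _ => rfl⟩
    rw [h1, ← hN, Fintype.card_subtype_compl]
    have := Fintype.card_subtype_le (fun x => g x = x)
    omega
  let E : Finset (Fin n × Fin n × Fin n) → Finset O := fun T =>
    Finset.univ.filter fun o => ∃ x y z, q x y z = o ∧ (x.1, y.1, z.1) ∈ T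
  let D : Finset (Fin n × Fin n × Fin n) → Finset (Fin n × I) := fun T =>
    Finset.univ.filter fun p => (p.1, p.2.1, p.1) ∈ T
  have hE : ∀ T T', IsFAS (f, I, T) → IsFAS (f, I, T') → E T = E T' → ∀ a b c,
      a ∉ I → b ∉ I → c ∉ I → (a, b, c) ∈ T → (a, b, c) ∈ T' := by
    intro T T' h h' heq a b c ha hb hc ht
    have hmem : q ⟨a, ha⟩ ⟨b, hb⟩ ⟨c, hc⟩ ∈ E T :=
      Finset.mem_filter.2 ⟨Finset.mem_univ _, _, _, _, rfl, ht⟩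
    rw [heq] at hmem
    obtain ⟨x, y, z, hxyz, ht'⟩ := (Finset.mem_filter.1 hmem).2
    exact hq (fun x y z => (x.1, y.1, z.1) ∈ T') (fun x y z => h'.1 x y z) _ _ _ _ _ _ hxyz ht'
  have hext : ∀ T T', IsFAS (f, I, T) → IsFAS (f, I, T') → D T = D T' → E T = E T' → T = T' := by
    intro T T' h h' hD heq
    refine h.ext_of_mem_iff h' (fun a i hi => ?_) fun a b c ha hb hc =>
      ⟨hE T T' h h' heq a b c ha hb hc, hE T' T h' h heq.symm a b c ha hb hc⟩
    have := Finset.ext_iff.1 hD (a, ⟨i, hi⟩)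
    simpa [D] using this
  refine ⟨Fintype.card O, ?_, ?_, ?_⟩
  · rw [hN] at hO
    generalize n - I.card = N at *
    generalize (Finset.univ.filter fun x => f x ≠ x).card = d at *
    generalize Fintype.card {x // g x = x} = s at *
    nlinarith [Nat.mul_le_mul_right N hs]
  · have hcard : (Finset.univ : Finset (Finset (Fin n × I) × Finset O)).card =
        2 ^ (n * I.card + Fintype.card O) := by
      simp [pow_add]
    rw [← hcard]
    refine Finset.card_le_card_of_injOn (fun T => (D T, E T)) (fun _ _ => Finset.mem_univ _) ?_
    intro T hT T' hT' heq
    simp only [Finset.coe_filter, Finset.mem_univ, true_and, Set.mem_ofPred_eq] at hT hT'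
    exact hext T T' hT hT' (congrArg Prod.fst heq) (congrArg Prod.snd heq)
  · intro hI
    obtain ⟨e, he⟩ := Finset.card_eq_one.1 hI
    have hD : ∀ T, IsFAS (f, I, T) → D T = Finset.univ := by
      intro T h
      refine Finset.filter_true_of_mem ?_
      rintro ⟨a, i, hi⟩ -
      obtain ⟨j, hj, ht⟩ := (h.2 a a).1 rfl
      have hij : j = i := by
        change j ∈ I at hj
        rw [he, Finset.mem_singleton] at hi hj
        rw [hi, hj]
      subst hij
      exact ht
    have hcard : (Finset.univ : Finset (Finset O)).card = 2 ^ Fintype.card O := by simp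
    rw [← hcard]
    refine Finset.card_le_card_of_injOn E (fun _ _ => Finset.mem_univ _) ?_
    intro T hT T' hT' heq
    simp only [Finset.coe_filter, Finset.mem_univ, true_and, Set.mem_ofPred_eq] at hT hT'
    exact hext T T' hT hT' ((hD T hT).trans (hD T' hT').symm) heq

theorem six_mul_choose_three (N : ℕ) : 6 * (N + 2).choose 3 = N * (N + 1) * (N + 2) := by
  have h2 : ∀ N : ℕ, 2 * (N + 2).choose 2 = (N + 1) * (N + 2) := by
    intro N
    induction N with
    | zero => rfl
    | succ N ih =>
      rw [Nat.choose_succ_succ' (N + 2) 1, mul_add, ih, Nat.choose_one_right]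
      ring
  induction N with
  | zero => rfl
  | succ N ih =>
    rw [Nat.choose_succ_succ' (N + 2) 2, mul_add, ih]
    linear_combination 3 * h2 N

open Classical in
theorem card_isFAS_and_le {n : ℕ} (p : (Fin n → Fin n) × Finset (Fin n) → Prop) :
    (Finset.univ.filter fun M : FASData n => IsFAS M ∧ p (M.1, M.2.1)).card ≤
      ∑ x ∈ Finset.univ.filter p,
        (Finset.univ.filter fun T => IsFAS (x.1, x.2, T)).card := by
  have hsub : (Finset.univ.filter fun M : FASData n => IsFAS M ∧ p (M.1, M.2.1)) ⊆
      (Finset.univ.filter p).biUnion fun x =>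
        (Finset.univ.filter fun T => IsFAS (x.1, x.2, T)).image fun T => (x.1, x.2, T) := by
    rintro ⟨f, I, T⟩ hM
    obtain ⟨h, hp⟩ := (Finset.mem_filter.1 hM).2
    exact Finset.mem_biUnion.2 ⟨(f, I), by simpa using hp,
      Finset.mem_image.2 ⟨T, by simpa using h, rfl⟩⟩
  exact (Finset.card_le_card hsub).trans (Finset.card_biUnion_le.trans
    (Finset.sum_le_sum fun _ _ => Finset.card_image_le))

theorem two_pow_le_mul_half_pow {m r c : ℕ} (h : m + r ≤ c) :
    (2 : ℝ) ^ m ≤ 2 ^ c * (1 / 2) ^ r := by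
  rw [one_div, inv_pow, ← div_eq_mul_inv, le_div_iff₀ (by positivity), ← pow_add]
  exact pow_le_pow_right₀ (by norm_num) h

theorem sum_pow_card_ne_le {n : ℕ} {y : ℝ} (hy : 0 ≤ y) :
    ∑ f : Fin n → Fin n, y ^ (Finset.univ.filter fun x => f x ≠ x).card ≤ (1 + n * y) ^ n := by
  calc ∑ f : Fin n → Fin n, y ^ (Finset.univ.filter fun x => f x ≠ x).card
      = ∑ f : Fin n → Fin n, ∏ x, if f x ≠ x then y else 1 := by
        refine Finset.sum_congr rfl fun f _ => ?_
        rw [Finset.prod_ite, Finset.prod_const, Finset.prod_const_one, mul_one]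
    _ = ∏ x : Fin n, ∑ b : Fin n, if b ≠ x then y else 1 := by
        rw [Finset.prod_univ_sum, Fintype.piFinset_univ]
    _ ≤ ∏ _x : Fin n, (1 + n * y) := by
        refine Finset.prod_le_prod (fun x _ => Finset.sum_nonneg fun b _ => ?_) fun x _ => ?_
        · split_ifs <;> positivity
        · calc ∑ b : Fin n, (if b ≠ x then y else 1)
              ≤ ∑ b : Fin n, ((if b = x then 1 else 0) + y) := by
                refine Finset.sum_le_sum fun b _ => ?_
                by_cases h : b = x <;> simp [h, hy]
            _ = 1 + n * y := by simp [Finset.sum_add_distrib]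
    _ = (1 + n * y) ^ n := by simp

open Classical in
theorem card_integral_not_symmetric_le (n : ℕ) :
    ((Finset.univ.filter fun M : FASData n => IsFAS M ∧ (M.2.1.card = 1 ∧ M.1 ≠ id)).card : ℝ) ≤
      (n * 2 ^ (n + 1).choose 3) * ((1 + n * (1 / 2) ^ ((n - 1) / 2)) ^ n - 1) := by
  set y : ℝ := (1 / 2) ^ ((n - 1) / 2) with hy
  have hy0 : 0 ≤ y := by positivity
  let w : (Fin n → Fin n) → ℝ := fun f => y ^ (Finset.univ.filter fun x => f x ≠ x).card
  have hbound : ∀ f : Fin n → Fin n, ∀ I : Finset (Fin n), I.card = 1 →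
      ((Finset.univ.filter fun T => IsFAS (f, I, T)).card : ℝ) ≤
        2 ^ (n + 1).choose 3 * w f := by
    intro f I hI
    by_cases hne : ∃ T, IsFAS (f, I, T)
    · obtain ⟨m, hm, -, hT⟩ := exists_card_isFAS_le f I hne
      have hn : 0 < n := by
        have := Finset.card_le_univ I
        rw [hI, Fintype.card_fin] at this
        exact this
      obtain ⟨N, rfl⟩ := Nat.exists_eq_succ_of_ne_zero hn.ne'
      simp only [Nat.succ_eq_add_one, hI, Nat.add_sub_cancel] at hm hy ⊢
      rw [← six_mul_choose_three] at hm
      change _ ≤ 2 ^ _ * y ^ _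
      rw [hy, ← pow_mul]
      refine le_trans (b := (2 : ℝ) ^ m) (by exact_mod_cast hT hI) (two_pow_le_mul_half_pow ?_)
      set d := (Finset.univ.filter fun x => f x ≠ x).card
      have h1 : 2 * (N / 2) * d ≤ N * d := Nat.mul_le_mul_right _ (Nat.mul_div_le N 2)
      change 6 * m + _ ≤ 6 * (N + 1 + 1).choose 3 at hm
      nlinarith
    · rw [Finset.filter_false_of_mem fun T _ hT => hne ⟨T, hT⟩]
      simp only [Finset.card_empty, Nat.cast_zero]
      positivity
  have hsub : (Finset.univ.filter fun x : (Fin n → Fin n) × Finset (Fin n) =>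
      x.2.card = 1 ∧ x.1 ≠ id) ⊆
      (Finset.univ.erase id) ×ˢ Finset.powersetCard 1 Finset.univ := by
    rintro ⟨f, I⟩ h
    obtain ⟨hI, hf⟩ := (Finset.mem_filter.1 h).2
    exact Finset.mem_product.2 ⟨Finset.mem_erase.2 ⟨hf, Finset.mem_univ _⟩,
      Finset.mem_powersetCard.2 ⟨Finset.subset_univ _, hI⟩⟩
  have hsum : ∑ f ∈ Finset.univ.erase id, w f ≤ (1 + n * y) ^ n - 1 := by
    rw [Finset.sum_erase_eq_sub (Finset.mem_univ _)]
    have h1 : w id = 1 := by simp [w]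
    rw [h1]
    exact sub_le_sub_right (sum_pow_card_ne_le hy0) 1
  calc ((Finset.univ.filter fun M : FASData n =>
        IsFAS M ∧ (M.2.1.card = 1 ∧ M.1 ≠ id)).card : ℝ)
      ≤ ∑ x ∈ Finset.univ.filter (fun x : (Fin n → Fin n) × Finset (Fin n) =>
          x.2.card = 1 ∧ x.1 ≠ id),
          ((Finset.univ.filter fun T => IsFAS (x.1, x.2, T)).card : ℝ) := by
        exact_mod_cast card_isFAS_and_le fun x => x.2.card = 1 ∧ x.1 ≠ id
    _ ≤ ∑ x ∈ Finset.univ.filter (fun x : (Fin n → Fin n) × Finset (Fin n) =>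
          x.2.card = 1 ∧ x.1 ≠ id), 2 ^ (n + 1).choose 3 * w x.1 :=
        Finset.sum_le_sum fun x hx => hbound _ _ (Finset.mem_filter.1 hx).2.1
    _ ≤ ∑ x ∈ (Finset.univ.erase id) ×ˢ Finset.powersetCard 1 Finset.univ,
          2 ^ (n + 1).choose 3 * w x.1 :=
        Finset.sum_le_sum_of_subset_of_nonneg hsub fun x _ _ => by positivity
    _ = (n * 2 ^ (n + 1).choose 3) * ∑ f ∈ Finset.univ.erase id, w f := by
        rw [Finset.sum_product]
        simp only [Finset.sum_const, Finset.card_powersetCard, Finset.card_univ, Fintype.card_fin,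
          Nat.choose_one_right, nsmul_eq_mul, Finset.mul_sum]
        exact Finset.sum_congr rfl fun f _ => by ring
    _ ≤ _ := mul_le_mul_of_nonneg_left hsum (by positivity)

open Classical in
theorem card_not_integral_le {n : ℕ} (hn : 12 ≤ n) :
    ((Finset.univ.filter fun M : FASData n => IsFAS M ∧ 2 ≤ M.2.1.card).card : ℝ) ≤
      2 ^ (n + 1).choose 3 * (2 * (n * (1 / 2) ^ ((n - 12) / 6))) ^ n := by
  have hbound : ∀ f : Fin n → Fin n, ∀ I : Finset (Fin n), 2 ≤ I.card →
      ((Finset.univ.filter fun T => IsFAS (f, I, T)).card : ℝ) ≤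
        2 ^ (n + 1).choose 3 * (1 / 2) ^ (n * ((n - 12) / 6)) := by
    intro f I hI
    by_cases hne : ∃ T, IsFAS (f, I, T)
    · obtain ⟨m, hm, hT, -⟩ := exists_card_isFAS_le f I hne
      refine le_trans (b := (2 : ℝ) ^ (n * I.card + m)) (by exact_mod_cast hT)
        (two_pow_le_mul_half_pow ?_)
      have hk : I.card ≤ n := by simpa using Finset.card_le_univ I
      obtain ⟨j, hj⟩ := Nat.exists_eq_add_of_le hI
      obtain ⟨N, hN⟩ := Nat.exists_eq_add_of_le hk
      have hNk : n - I.card = N := by omega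
      have hr : 6 * ((n - 12) / 6) + 12 ≤ n := by omega
      rw [hNk] at hm
      set r := (n - 12) / 6
      have hC := six_mul_choose_three (n - 1)
      have e1 : n - 1 = N + (j + 1) := by omega
      have e2 : n - 1 + 2 = n + 1 := by omega
      have e3 : n - 1 + 1 = n := by omega
      rw [e2, e3, e1] at hC
      have h1 : N * (N + 1) * (N + 2) ≤ N * n * (n + 1) :=
        Nat.mul_le_mul (Nat.mul_le_mul_left _ (by omega)) (by omega)
      have h2 : (j + 1) * n * (6 * r + 12) ≤ (j + 1) * n * (n + 1) :=
        Nat.mul_le_mul_left _ (by omega)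
      rw [hj]
      have h3 : 0 ≤ j * n * r := Nat.zero_le _
      have h4 : 0 ≤ j * n := Nat.zero_le _
      nlinarith
    · rw [Finset.filter_false_of_mem fun T _ hT => hne ⟨T, hT⟩]
      simp only [Finset.card_empty, Nat.cast_zero]
      positivity
  calc ((Finset.univ.filter fun M : FASData n => IsFAS M ∧ 2 ≤ M.2.1.card).card : ℝ)
      ≤ ∑ x ∈ Finset.univ.filter (fun x : (Fin n → Fin n) × Finset (Fin n) => 2 ≤ x.2.card),
          ((Finset.univ.filter fun T => IsFAS (x.1, x.2, T)).card : ℝ) := by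
        have h := card_isFAS_and_le (n := n) fun x => 2 ≤ x.2.card
        rw [← Nat.cast_sum, Nat.cast_le]
        convert h
    _ ≤ ∑ x ∈ Finset.univ.filter (fun x : (Fin n → Fin n) × Finset (Fin n) => 2 ≤ x.2.card),
          2 ^ (n + 1).choose 3 * (1 / 2 : ℝ) ^ (n * ((n - 12) / 6)) :=
        Finset.sum_le_sum fun x hx => hbound _ _ (Finset.mem_filter.1 hx).2
    _ ≤ ∑ x : (Fin n → Fin n) × Finset (Fin n),
          2 ^ (n + 1).choose 3 * (1 / 2 : ℝ) ^ (n * ((n - 12) / 6)) :=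
        Finset.sum_le_sum_of_subset_of_nonneg (Finset.subset_univ _) fun x _ _ => by positivity
    _ = _ := by
        rw [Finset.sum_const, Finset.card_univ, nsmul_eq_mul, mul_pow, mul_pow, ← pow_mul,
          mul_comm n ((n - 12) / 6)]
        simp
        ring

open Classical in
theorem card_not_good_le {n : ℕ} (hn : 12 ≤ n) (K : ℕ) :
    ((Finset.univ.filter fun M : FASData n => IsFAS M ∧
      ¬ ∃ e, IsSymmIntegral M e ∧ ∀ k < K, HasExtension k M e).card : ℝ) ≤
      (n * 2 ^ (n + 1).choose 3) * (((1 + n * (1 / 2) ^ ((n - 1) / 2)) ^ n - 1) +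
        (2 * (n * (1 / 2) ^ ((n - 12) / 6))) ^ n +
        ∑ k ∈ Finset.range K, ((n : ℝ) ^ k * 2 ^ ((k + 1) * (k + 1)) *
          (1 - (1 / 2) ^ ((k + 1) * (k + 1))) ^ (n - (k + 1)))) := by
  have hsub : (Finset.univ.filter fun M : FASData n => IsFAS M ∧
      ¬ ∃ e, IsSymmIntegral M e ∧ ∀ k < K, HasExtension k M e) ⊆
      ((Finset.univ.filter fun M : FASData n => IsFAS M ∧ (M.2.1.card = 1 ∧ M.1 ≠ id)) ∪
      (Finset.univ.filter fun M : FASData n => IsFAS M ∧ 2 ≤ M.2.1.card)) ∪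
      (Finset.range K).biUnion fun k => Finset.univ.filter fun M : FASData n =>
        ∃ e, IsSymmIntegral M e ∧ ¬ HasExtension k M e := by
    intro M hM
    obtain ⟨h, hgood⟩ := (Finset.mem_filter.1 hM).2
    simp only [Finset.mem_union, Finset.mem_filter, Finset.mem_univ, true_and, Finset.mem_biUnion,
      Finset.mem_range]
    by_cases hI : 2 ≤ M.2.1.card
    · exact Or.inl (Or.inr ⟨h, hI⟩)
    have hpos : 0 < M.2.1.card := by
      have a : Fin n := ⟨0, by omega⟩
      obtain ⟨i, hi, -⟩ := (h.2 a a).1 rfl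
      exact Finset.card_pos.2 ⟨i, hi⟩
    have hI1 : M.2.1.card = 1 := by omega
    by_cases hf : M.1 = id
    · obtain ⟨e, he⟩ := Finset.card_eq_one.1 hI1
      push Not at hgood
      obtain ⟨k, hk, hext⟩ := hgood e ⟨h, hf, he⟩
      exact Or.inr ⟨k, hk, e, ⟨h, hf, he⟩, hext⟩
    · exact Or.inl (Or.inl ⟨h, hI1, hf⟩)
  have hcard := (Finset.card_le_card hsub).trans ((Finset.card_union_le _ _).trans
    (Nat.add_le_add (Finset.card_union_le _ _) Finset.card_biUnion_le))
  have hcard' := (Nat.cast_le (α := ℝ)).2 hcard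
  rw [Nat.cast_add, Nat.cast_add, Nat.cast_sum] at hcard'
  refine hcard'.trans ?_
  rw [mul_add, mul_add, Finset.mul_sum]
  refine add_le_add (add_le_add (card_integral_not_symmetric_le n) ?_)
    (Finset.sum_le_sum fun k _ => card_not_hasExtension_le n k)
  refine (card_not_integral_le hn).trans (mul_le_mul_of_nonneg_right ?_ (by positivity))
  have : (1 : ℝ) ≤ n := by exact_mod_cast (by omega : 1 ≤ n)
  exact le_mul_of_one_le_left (by positivity) this

theorem tendsto_pow_mul_half_pow_div (p a : ℕ) {c : ℕ} (hc : 0 < c) :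
    Tendsto (fun n : ℕ => (n : ℝ) ^ p * (1 / 2) ^ ((n - a) / c)) atTop (𝓝 0) := by
  have hr : Tendsto (fun n : ℕ => (n - a) / c) atTop atTop :=
    (Nat.tendsto_div_const_atTop hc.ne').comp (tendsto_sub_atTop_nat a)
  have h0 : Tendsto (fun r : ℕ => ((c + a : ℕ) : ℝ) ^ p * 2 *
      (((r + 1 : ℕ) : ℝ) ^ p * (1 / 2) ^ (r + 1))) atTop (𝓝 0) := by
    have h := (tendsto_add_atTop_iff_nat 1).2
      (tendsto_pow_const_mul_const_pow_of_abs_lt_one p (r := (1 / 2 : ℝ)) (by norm_num))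
    simpa only [mul_zero] using h.const_mul (((c + a : ℕ) : ℝ) ^ p * 2)
  refine squeeze_zero (fun n => by positivity) (fun n => ?_) (h0.comp hr)
  have hle : n ≤ (c + a) * ((n - a) / c + 1) := by
    have h1 := Nat.div_add_mod (n - a) c
    have h2 := Nat.mod_lt (n - a) hc
    have h3 : 0 ≤ a * ((n - a) / c) := Nat.zero_le _
    have h4 : n ≤ (n - a) + a := by omega
    nlinarith
  calc (n : ℝ) ^ p * (1 / 2) ^ ((n - a) / c)
      ≤ (((c + a) * ((n - a) / c + 1) : ℕ) : ℝ) ^ p * (1 / 2) ^ ((n - a) / c) := by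
        gcongr
    _ = _ := by
        simp only [Function.comp]
        rw [Nat.cast_mul, mul_pow, pow_succ (1 / 2 : ℝ)]
        ring

theorem tendsto_one_add_pow_sub_one :
    Tendsto (fun n : ℕ => (1 + (n : ℝ) * (1 / 2) ^ ((n - 1) / 2)) ^ n - 1) atTop (𝓝 0) := by
  have h := (Real.continuous_exp.tendsto 0).comp
    (tendsto_pow_mul_half_pow_div 2 1 (c := 2) (by norm_num))
  have h' := h.sub_const 1
  rw [Real.exp_zero, sub_self] at h'
  refine squeeze_zero (fun n => ?_) (fun n => ?_) h'
  · rw [sub_nonneg]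
    exact one_le_pow₀ (le_add_of_nonneg_right (by positivity))
  · refine sub_le_sub_right ?_ 1
    calc (1 + (n : ℝ) * (1 / 2) ^ ((n - 1) / 2)) ^ n
        ≤ Real.exp ((n : ℝ) * (1 / 2) ^ ((n - 1) / 2)) ^ n := by
          gcongr
          rw [add_comm]
          exact Real.add_one_le_exp _
      _ = _ := by
          rw [← Real.exp_nat_mul, Function.comp, pow_two, mul_assoc]

theorem tendsto_two_mul_pow :
    Tendsto (fun n : ℕ => (2 * ((n : ℝ) * (1 / 2) ^ ((n - 12) / 6))) ^ n) atTop (𝓝 0) := by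
  have h : Tendsto (fun n : ℕ => 2 * ((n : ℝ) * (1 / 2) ^ ((n - 12) / 6))) atTop (𝓝 0) := by
    simpa using (tendsto_pow_mul_half_pow_div 1 12 (c := 6) (by norm_num)).const_mul 2
  refine squeeze_zero' (Eventually.of_forall fun n => by positivity) ?_ h
  filter_upwards [h.eventually_le_const one_pos, eventually_ne_atTop 0] with n h1 hn
  exact pow_le_of_le_one (by positivity) h1 hn

theorem tendsto_pow_mul_pow_sub (k a : ℕ) (C : ℝ) {r : ℝ} (h0 : 0 < r) (h1 : r < 1) :
    Tendsto (fun n : ℕ => (n : ℝ) ^ k * C * r ^ (n - a)) atTop (𝓝 0) := by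
  have h := (tendsto_pow_const_mul_const_pow_of_abs_lt_one k
    (r := r) (by rwa [abs_of_pos h0])).const_mul (C / r ^ a)
  rw [mul_zero] at h
  refine h.congr' ?_
  filter_upwards [eventually_ge_atTop a] with n hn
  rw [pow_sub₀ r h0.ne' hn]
  field_simp

open Classical in
theorem tendsto_card_div_card_isFAS {K : ℕ} (P : ∀ n, FASData n → Prop)
    (hP : ∀ n (M : FASData n) e, IsSymmIntegral M e → (∀ k < K, HasExtension k M e) → ¬ P n M) :
    Tendsto (fun n : ℕ => (Nat.card {M : FASData n // IsFAS M ∧ P n M} : ℝ) /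
      (Nat.card {M : FASData n // IsFAS M} : ℝ)) atTop (𝓝 0) := by
  have hsum : Tendsto (fun n : ℕ => ∑ k ∈ Finset.range K, ((n : ℝ) ^ k * 2 ^ ((k + 1) * (k + 1)) *
      (1 - (1 / 2) ^ ((k + 1) * (k + 1))) ^ (n - (k + 1)))) atTop (𝓝 0) := by
    rw [← Finset.sum_const_zero (M := ℝ) (s := Finset.range K)]
    refine tendsto_finsetSum _ fun k _ => tendsto_pow_mul_pow_sub k (k + 1) _ ?_ ?_
    · rw [sub_pos]
      exact pow_lt_one₀ (by norm_num) (by norm_num) (by positivity)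
    · rw [sub_lt_self_iff]
      positivity
  have h := (tendsto_one_add_pow_sub_one.add tendsto_two_mul_pow).add hsum
  rw [add_zero, add_zero] at h
  refine squeeze_zero' (Eventually.of_forall fun n => by positivity) ?_ h
  filter_upwards [eventually_ge_atTop 12] with n hn
  have hpos : (0 : ℝ) < n * 2 ^ (n + 1).choose 3 := by
    have : (0 : ℝ) < n := by exact_mod_cast (by omega : 0 < n)
    positivity
  have hF : (n * 2 ^ (n + 1).choose 3 : ℝ) ≤ Nat.card {M : FASData n // IsFAS M} := by
    exact_mod_cast mul_two_pow_le_card_isFAS n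
  have hle : (Nat.card {M : FASData n // IsFAS M ∧ P n M} : ℝ) ≤
      (Finset.univ.filter fun M : FASData n => IsFAS M ∧
        ¬ ∃ e, IsSymmIntegral M e ∧ ∀ k < K, HasExtension k M e).card := by
    rw [Nat.card_eq_fintype_card, Fintype.card_subtype, Nat.cast_le]
    refine Finset.card_le_card fun M hM => ?_
    simp only [Finset.mem_filter, Finset.mem_univ, true_and] at hM ⊢
    exact ⟨hM.1, fun ⟨e, he, hext⟩ => hP n M e he hext hM.2⟩
  refine (div_le_div₀ (Nat.cast_nonneg _) le_rfl hpos hF).trans ?_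
  rw [div_le_iff₀ hpos, mul_comm]
  exact hle.trans (card_not_good_le hn K)

/-- The class `FAS` has a 0–1 law: for every first-order sentence in the
signature `{f, I, T}`, the fraction of labelled FAS structures satisfying it
tends either to 0 or to 1. -/
theorem stmt12 (σ : fasLang.Sentence) :
    Tendsto (fun n : ℕ =>
      (Nat.card {M : FASData n // IsFAS M ∧ SatSentence M σ} : ℝ) /
      (Nat.card {M : FASData n // IsFAS M} : ℝ)) atTop (𝓝 0) ∨
    Tendsto (fun n : ℕ =>
      (Nat.card {M : FASData n // IsFAS M ∧ SatSentence M σ} : ℝ) /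
      (Nat.card {M : FASData n // IsFAS M} : ℝ)) atTop (𝓝 1) := by
  classical
  obtain ⟨K, hK⟩ := exists_realize_iff σ
  by_cases hgood : ∃ (n : ℕ) (M : FASData n) (e : Fin n), IsSymmIntegral M e ∧
      (∀ k < K, HasExtension k M e) ∧ SatSentence M σ
  · obtain ⟨n, M, e, hM, hext, hsat⟩ := hgood
    right
    have h := (tendsto_card_div_card_isFAS (K := K) (fun _ M' => ¬ SatSentence M' σ)
      fun m M' e' hM' hext' => not_not.2 ((hK hM hM' hext hext' default default default default
        ⟨fun i => i.elim0, fun i => i.elim0, fun i => i.elim0⟩).1 hsat)).const_sub 1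
    rw [sub_zero] at h
    refine h.congr' ?_
    filter_upwards [eventually_ge_atTop 1] with m hm
    have hF : (Nat.card {M : FASData m // IsFAS M} : ℝ) ≠ 0 := by
      have h1 := mul_two_pow_le_card_isFAS m
      have h2 : 0 < m * 2 ^ (m + 1).choose 3 := by positivity
      exact_mod_cast (h2.trans_le h1).ne'
    rw [sub_eq_iff_eq_add, ← add_div, eq_comm, div_eq_one_iff_eq hF]
    simp only [Nat.card_eq_fintype_card, Fintype.card_subtype]
    simp only [← Finset.filter_filter]
    exact_mod_cast Finset.card_filter_add_card_filter_not _
  · left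
    exact tendsto_card_div_card_isFAS (K := K) _ fun m M e hM hext hsat =>
      hgood ⟨m, M, e, hM, hext, hsat⟩
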